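/- arXiv:2305.14138 — 11 statements merged into one kernel-verified Lean document; each statement's English description precedes it below -/
import Mathlib

section
/- Let X be a nonempty set and f : X → X a map. Then f is incompressible (i.e., there is no nonempty proper subset I ⊊ X with f(I) ⊆ I) if and only if there exist a positive integer n and a bijection φ : X → ℤ/nℤ such that φ(f(x)) = φ(x) + 1 for all x ∈ X; in particular X is then finite and f is a cycle of length |X|. Moreover, the map R_f : X × X → X × X, R_f(x,y) = (f(x), f(y)), is a simple YB-solution if and only if X is finite and f is a cycle of length |X|. -/
/-- The flip on the last two factors of `X × X × X`, i.e. `id × τ`. -/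
def flip23 {X : Type*} : X × X × X → X × X × X := fun p => (p.1, p.2.2, p.2.1)

/-- `R¹² = R × id`. -/
def R12 {X : Type*} (R : X × X → X × X) : X × X × X → X × X × X :=
  fun p => ((R (p.1, p.2.1)).1, (R (p.1, p.2.1)).2, p.2.2)

/-- `R²³ = id × R`. -/
def R23 {X : Type*} (R : X × X → X × X) : X × X × X → X × X × X :=
  fun p => (p.1, R (p.2.1, p.2.2))

/-- `R¹³ = (id × τ) ∘ R¹² ∘ (id × τ)`. -/
def R13 {X : Type*} (R : X × X → X × X) : X × X × X → X × X × X :=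
  flip23 ∘ R12 R ∘ flip23

/-- `R` is a set-theoretic solution of the quantum Yang–Baxter equation. -/
def IsYB {X : Type*} (R : X × X → X × X) : Prop :=
  R12 R ∘ R13 R ∘ R23 R = R23 R ∘ R13 R ∘ R12 R

/-- A self-map `f` is incompressible: no nonempty proper subset `I ⊊ X` satisfies `f(I) ⊆ I`;
equivalently, every nonempty `f`-invariant subset is all of `X`. -/
def IncompressibleMap {X : Type*} (f : X → X) : Prop :=
  ∀ I : Set X, I.Nonempty → (∀ x ∈ I, f x ∈ I) → I = Set.univ

/-- A nonempty subset `I ⊆ X` is an ideal of `R : X × X → X × X` if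
`R(I × X) ⊆ I × X` and `R(X × I) ⊆ X × I`. -/
def IsIdeal {X : Type*} (R : X × X → X × X) (I : Set X) : Prop :=
  I.Nonempty ∧ (∀ x ∈ I, ∀ y : X, (R (x, y)).1 ∈ I) ∧ (∀ x : X, ∀ y ∈ I, (R (x, y)).2 ∈ I)

/-- `R` is simple if its only ideal is `X` itself. -/
def IsSimple {X : Type*} (R : X × X → X × X) : Prop :=
  ∀ I : Set X, IsIdeal R I → I = Set.univ

open Function in
/-- An incompressible self-map of a nonempty set is a cycle. -/
theorem IncompressibleMap.exists_equiv_zmod {X : Type*} [Nonempty X] {f : X → X}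
    (hf : IncompressibleMap f) :
    ∃ n : ℕ, 0 < n ∧ ∃ φ : X ≃ ZMod n, ∀ x : X, φ (f x) = φ x + 1 := by
  obtain ⟨x⟩ := ‹Nonempty X›
  have horbit (y z : X) : ∃ k : ℕ, f^[k] y = z := by
    have h := hf (Set.range fun k : ℕ => f^[k] y) ⟨y, 0, rfl⟩ (by
      rintro _ ⟨k, rfl⟩
      exact ⟨k + 1, iterate_succ_apply' f k y⟩)
    exact Set.range_eq_univ.1 h z
  obtain ⟨k, hk⟩ := horbit (f x) x
  have hpos : 0 < minimalPeriod f x :=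
    (show IsPeriodicPt f (k + 1) x from hk).minimalPeriod_pos k.succ_pos
  have : NeZero (minimalPeriod f x) := ⟨hpos.ne'⟩
  let g : ZMod (minimalPeriod f x) → X := fun k => f^[k.val] x
  have hgcast (m : ℕ) : g m = f^[m] x := by
    simp only [g, ZMod.val_natCast, iterate_mod_minimalPeriod_eq]
  have hg : Bijective g := by
    refine ⟨fun a b hab => ZMod.val_injective _ ?_, fun z => ?_⟩
    · exact (iterate_eq_iterate_iff_of_lt_minimalPeriod a.val_lt b.val_lt).1 hab
    · obtain ⟨m, rfl⟩ := horbit x z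
      exact ⟨m, hgcast m⟩
  have hsucc (a : ZMod (minimalPeriod f x)) : g (a + 1) = f (g a) := by
    obtain ⟨m, rfl⟩ := ZMod.natCast_zmod_surjective a
    rw [← Nat.cast_succ, hgcast, hgcast, iterate_succ_apply']
  refine ⟨_, hpos, (Equiv.ofBijective g hg).symm, fun z => ?_⟩
  rw [Equiv.symm_apply_eq, Equiv.ofBijective_apply, hsucc]
  exact congrArg f ((Equiv.ofBijective g hg).apply_symm_apply z).symm

/-- A cycle is incompressible. -/
theorem IncompressibleMap.of_equiv_zmod {X : Type*} {f : X → X} {n : ℕ} (hn : 0 < n)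
    (φ : X ≃ ZMod n) (hφ : ∀ x : X, φ (f x) = φ x + 1) : IncompressibleMap f := by
  have : NeZero n := ⟨hn.ne'⟩
  rintro I ⟨x, hx⟩ hI
  have hiter (k : ℕ) : φ.symm (φ x + k) ∈ I := by
    induction k with
    | zero => simpa using hx
    | succ k ih =>
      have h := hI _ ih
      rwa [← φ.symm_apply_apply (f _), hφ, φ.apply_symm_apply, add_assoc,
        ← Nat.cast_succ] at h
  refine Set.eq_univ_of_forall fun y => ?_
  simpa using hiter (φ y - φ x).val

theorem isYB_prodMap {X : Type*} (f : X → X) : IsYB (fun p : X × X => (f p.1, f p.2)) :=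
  rfl

theorem isSimple_prodMap_iff {X : Type*} (f : X → X) :
    IsSimple (fun p : X × X => (f p.1, f p.2)) ↔ IncompressibleMap f :=
  ⟨fun h I hne hI => h I ⟨hne, fun x hx _ => hI x hx, fun _ y hy => hI y hy⟩,
    fun h I hI => h I hI.1 fun x hx => hI.2.1 x hx x⟩

theorem stmt2 {X : Type*} [Nonempty X] (f : X → X) :
    (IncompressibleMap f ↔
      ∃ n : ℕ, 0 < n ∧ ∃ φ : X ≃ ZMod n, ∀ x : X, φ (f x) = φ x + 1) ∧
    ((IsYB (fun p : X × X => (f p.1, f p.2)) ∧ IsSimple (fun p : X × X => (f p.1, f p.2))) ↔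
      (Finite X ∧ IncompressibleMap f)) := by
  refine ⟨⟨fun hf => hf.exists_equiv_zmod, ?_⟩, ?_⟩
  · rintro ⟨n, hn, φ, hφ⟩
    exact .of_equiv_zmod hn φ hφ
  · rw [isSimple_prodMap_iff]
    refine ⟨fun h => ⟨?_, h.2⟩, fun h => ⟨isYB_prodMap f, h.2⟩⟩
    obtain ⟨n, hn, φ, -⟩ := h.2.exists_equiv_zmod
    have : NeZero n := ⟨hn.ne'⟩
    exact Finite.of_equiv _ φ.symm
end

section
/- Let F be an incompressible family of pairwise commuting self-maps of a nonempty set X. Then every f ∈ F is a bijection X → X, and the submonoid of the monoid X^X of all self-maps of X (under composition) generated by F is a group; in particular, for every f ∈ F the inverse map f⁻¹ belongs to the submonoid generated by F. -/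
/-- The submonoid generated by an incompressible family acts transitively. -/
theorem exists_mem_closure_apply_eq_of_incompressible {X : Type*} (F : Set (Function.End X))
    (hinc : ∀ I : Set X, I.Nonempty → (∀ f ∈ F, ∀ x ∈ I, f x ∈ I) → I = Set.univ)
    (x y : X) : ∃ k ∈ Submonoid.closure F, k x = y := by
  have h := hinc {z | ∃ k ∈ Submonoid.closure F, k x = z} ⟨x, 1, one_mem _, rfl⟩ (by
    rintro f hf _ ⟨k, hk, rfl⟩
    exact ⟨f * k, mul_mem (Submonoid.subset_closure hf) hk, rfl⟩)
  exact h.ge (Set.mem_univ y)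

/-- In a transitive commuting submonoid of self-maps, every element is invertible. -/
theorem exists_mem_mul_eq_one_of_transitive {X : Type*} [Nonempty X]
    (M : Submonoid (Function.End X)) (hcomm : ∀ f ∈ M, ∀ g ∈ M, f * g = g * f)
    (htrans : ∀ x y : X, ∃ k ∈ M, k x = y) :
    ∀ g ∈ M, ∃ h ∈ M, g * h = 1 ∧ h * g = 1 := by
  intro g hg
  obtain ⟨x₀⟩ := ‹Nonempty X›
  obtain ⟨h, hh, hx⟩ := htrans (g x₀) x₀
  have key : h * g = 1 := by
    funext x
    obtain ⟨k, hk, rfl⟩ := htrans x₀ x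
    exact (congrFun (hcomm _ (mul_mem hh hg) k hk) x₀).trans (congrArg k hx)
  exact ⟨h, hh, (hcomm g hg h hh).trans key, key⟩

theorem stmt3 {X : Type*} [Nonempty X] (F : Set (Function.End X))
    (hinc : ∀ I : Set X, I.Nonempty → (∀ f ∈ F, ∀ x ∈ I, f x ∈ I) → I = Set.univ)
    (hcomm : ∀ f ∈ F, ∀ g ∈ F, f * g = g * f) :
    (∀ f ∈ F, Function.Bijective f) ∧
    (∀ g ∈ Submonoid.closure F, ∃ h ∈ Submonoid.closure F, g * h = 1 ∧ h * g = 1) ∧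
    (∀ f ∈ F, ∃ h ∈ Submonoid.closure F, f * h = 1 ∧ h * f = 1) := by
  have hM : ∀ f ∈ Submonoid.closure F, ∀ g ∈ Submonoid.closure F, f * g = g * f := by
    intro f hf g hg
    have := Submonoid.isMulCommutative_closure _ hcomm
    exact congrArg Subtype.val
      (mul_comm' (⟨f, hf⟩ : Submonoid.closure F) (⟨g, hg⟩ : Submonoid.closure F))
  have hinv := exists_mem_mul_eq_one_of_transitive _ hM
    (exists_mem_closure_apply_eq_of_incompressible F hinc)
  refine ⟨fun f hf => ?_, hinv, fun f hf => hinv f (Submonoid.subset_closure hf)⟩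
  obtain ⟨h, -, h₁, h₂⟩ := hinv f (Submonoid.subset_closure hf)
  exact Function.bijective_iff_has_inverse.2 ⟨h, congrFun h₂, congrFun h₁⟩
end

section
/- Let F = (f_i)_{i∈I} be an incompressible family of pairwise commuting self-maps of a nonempty set X, and let Γ be the submonoid of X^X (under composition) generated by F. Then Γ is an abelian group of bijections of X acting freely and transitively on X; consequently, for any x₀ ∈ X the evaluation map Γ → X, γ ↦ γ(x₀), is a bijection. In particular, X carries an abelian group structure (transported from Γ) under which each f_i acts as translation by an element of X, and these elements generate the group as a monoid. -/
/-- `X` carries an abelian group structure under which each `f i` acts as translation by an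
element `t i`, and the `t i` generate the group as a monoid. -/
def IsTranslationGenerated {X ι : Type*} (f : ι → X → X) : Prop :=
  ∃ G : CommGroup X,
    haveI := G
    ∃ t : ι → X, (∀ i, ∀ x : X, f i x = t i * x) ∧ Submonoid.closure (Set.range t) = ⊤

section Incompressible

variable {X : Type*}

theorem Submonoid.exists_mem_closure_apply_eq {ι : Type*} {f : ι → Function.End X}
    (hinc : ∀ I : Set X, I.Nonempty → (∀ i, ∀ x ∈ I, f i x ∈ I) → I = Set.univ) (x y : X) :
    ∃ g ∈ Submonoid.closure (Set.range f), g x = y := by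
  have h := hinc {z | ∃ g ∈ Submonoid.closure (Set.range f), g x = z} ⟨x, 1, one_mem _, rfl⟩ (by
    rintro i _ ⟨g, hg, rfl⟩
    exact ⟨f i * g, mul_mem (Submonoid.subset_closure ⟨i, rfl⟩) hg, rfl⟩)
  exact Set.eq_univ_iff_forall.1 h y

theorem Submonoid.mul_comm_of_mem_closure_range {M ι : Type*} [Monoid M] {f : ι → M}
    (hcomm : ∀ i j, f i * f j = f j * f i) {g h : M}
    (hg : g ∈ Submonoid.closure (Set.range f)) (hh : h ∈ Submonoid.closure (Set.range f)) :
    g * h = h * g := by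
  have := Submonoid.isMulCommutative_closure M (s := Set.range f) (by
    rintro _ ⟨i, rfl⟩ _ ⟨j, rfl⟩
    exact hcomm i j)
  exact congrArg Subtype.val (mul_comm'
    (⟨g, hg⟩ : Submonoid.closure (Set.range f)) ⟨h, hh⟩)

variable {S : Submonoid (Function.End X)}

theorem Submonoid.eq_one_of_apply_eq (hcomm : ∀ g ∈ S, ∀ h ∈ S, g * h = h * g)
    (htrans : ∀ x y : X, ∃ g ∈ S, g x = y) {g : Function.End X} (hg : g ∈ S) {x : X}
    (hx : g x = x) : g = 1 := by
  funext y
  obtain ⟨h, hh, rfl⟩ := htrans x y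
  exact (congrFun (hcomm g hg h hh) x).trans (congrArg h hx)

theorem Submonoid.exists_inverse_of_transitive [Nonempty X]
    (hcomm : ∀ g ∈ S, ∀ h ∈ S, g * h = h * g)
    (htrans : ∀ x y : X, ∃ g ∈ S, g x = y) {g : Function.End X} (hg : g ∈ S) :
    ∃ h ∈ S, g * h = 1 ∧ h * g = 1 := by
  obtain ⟨x⟩ := ‹Nonempty X›
  obtain ⟨h, hh, hx⟩ := htrans (g x) x
  have h1 : h * g = 1 := eq_one_of_apply_eq hcomm htrans (mul_mem hh hg) hx
  exact ⟨h, hh, (hcomm g hg h hh).trans h1, h1⟩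

theorem Submonoid.bijective_eval_of_transitive
    (hcomm : ∀ g ∈ S, ∀ h ∈ S, g * h = h * g)
    (htrans : ∀ x y : X, ∃ g ∈ S, g x = y) (x₀ : X) :
    Function.Bijective (fun g : S => (g : Function.End X) x₀) := by
  refine ⟨?_, fun y => ?_⟩
  · rintro ⟨g, hg⟩ ⟨h, hh⟩ hgh
    refine Subtype.ext (funext fun y => ?_)
    obtain ⟨k, hk, rfl⟩ := htrans x₀ y
    exact (congrFun (hcomm g hg k hk) x₀).trans
      ((congrArg k hgh).trans (congrFun (hcomm k hk h hh) x₀))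
  · obtain ⟨g, hg, rfl⟩ := htrans x₀ y
    exact ⟨⟨g, hg⟩, rfl⟩

theorem isTranslationGenerated_of_transitive [Nonempty X] {ι : Type*} {f : ι → Function.End X}
    (hcomm : ∀ i j, f i * f j = f j * f i)
    (htrans : ∀ x y : X, ∃ g ∈ Submonoid.closure (Set.range f), g x = y) :
    IsTranslationGenerated (fun i => (f i : X → X)) := by
  obtain ⟨x₀⟩ := ‹Nonempty X›
  have : Nonempty X := ⟨x₀⟩
  have hc : ∀ g ∈ Submonoid.closure (Set.range f), ∀ h ∈ Submonoid.closure (Set.range f),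
      g * h = h * g := fun _ hg _ hh => Submonoid.mul_comm_of_mem_closure_range hcomm hg hh
  have hinv : ∀ g : Submonoid.closure (Set.range f), ∃ h, h * g = 1 := fun ⟨g, hg⟩ => by
    obtain ⟨h, hh, -, h1⟩ := Submonoid.exists_inverse_of_transitive hc htrans hg
    exact ⟨⟨h, hh⟩, Subtype.ext h1⟩
  choose inv hinv using hinv
  let e := Equiv.ofBijective _ (Submonoid.bijective_eval_of_transitive hc htrans x₀)
  let G : CommGroup (Submonoid.closure (Set.range f)) :=
    { (inferInstance : Monoid (Submonoid.closure (Set.range f))) with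
      inv := inv
      inv_mul_cancel := hinv
      mul_comm := fun g h => Subtype.ext (hc g g.2 h h.2) }
  let GX : CommGroup X := e.symm.commGroup
  have hmul (g : Submonoid.closure (Set.range f)) (x : X) : e g * x = g.1 x := by
    obtain ⟨h, rfl⟩ := e.surjective x
    change e (e.symm (e g) * e.symm (e h)) = _
    rw [e.symm_apply_apply, e.symm_apply_apply]
    rfl
  refine ⟨GX, fun i => f i x₀, fun i x => (hmul ⟨f i, Submonoid.subset_closure ⟨i, rfl⟩⟩ x).symm,
    (Submonoid.eq_top_iff' _).2 fun y => ?_⟩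
  obtain ⟨g, hg, rfl⟩ := htrans x₀ y
  induction hg using Submonoid.closure_induction with
  | mem g hg =>
    obtain ⟨i, rfl⟩ := hg
    exact Submonoid.subset_closure ⟨i, rfl⟩
  | one => exact one_mem _
  | mul g h hg hh ihg ihh =>
    have := mul_mem ihg ihh
    rwa [show g x₀ = e ⟨g, hg⟩ from rfl, hmul] at this

end Incompressible

theorem stmt4 {X : Type*} [Nonempty X] {ι : Type*} (f : ι → Function.End X)
    (hinc : ∀ I : Set X, I.Nonempty → (∀ i, ∀ x ∈ I, f i x ∈ I) → I = Set.univ)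
    (hcomm : ∀ i j, f i * f j = f j * f i) :
    (∀ g ∈ Submonoid.closure (Set.range f), Function.Bijective g) ∧
    (∀ g ∈ Submonoid.closure (Set.range f), ∀ h ∈ Submonoid.closure (Set.range f),
      g * h = h * g) ∧
    (∀ g ∈ Submonoid.closure (Set.range f), ∃ h ∈ Submonoid.closure (Set.range f),
      g * h = 1 ∧ h * g = 1) ∧
    (∀ g ∈ Submonoid.closure (Set.range f), (∃ x : X, g x = x) → g = 1) ∧
    (∀ x y : X, ∃ g ∈ Submonoid.closure (Set.range f), g x = y) ∧
    (∀ x₀ : X, Function.Bijective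
      (fun g : Submonoid.closure (Set.range f) => (g : Function.End X) x₀)) ∧
    IsTranslationGenerated (fun i => (f i : X → X)) := by
  have hc : ∀ g ∈ Submonoid.closure (Set.range f), ∀ h ∈ Submonoid.closure (Set.range f),
      g * h = h * g := fun _ hg _ hh => Submonoid.mul_comm_of_mem_closure_range hcomm hg hh
  have htrans := Submonoid.exists_mem_closure_apply_eq hinc
  refine ⟨fun g hg => ?_, hc, fun _ => Submonoid.exists_inverse_of_transitive hc htrans,
    fun _ hg ⟨_, hx⟩ => Submonoid.eq_one_of_apply_eq hc htrans hg hx, htrans,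
    Submonoid.bijective_eval_of_transitive hc htrans,
    isTranslationGenerated_of_transitive hcomm htrans⟩
  obtain ⟨h, -, hgh, hhg⟩ := Submonoid.exists_inverse_of_transitive hc htrans hg
  exact Function.bijective_iff_has_inverse.2 ⟨h, congrFun hhg, congrFun hgh⟩
end

section
/- Let p be a prime, X = ℤ/pℤ, and h₁, h₂ ∈ ℤ/pℤ not both zero; define R : X × X → X × X by R(x,x') = (x' + h₂, x + h₁), a YB-solution. Then: (1) there is no morphism of solutions from any Lyubashenko-type YB-solution (Y, R_Y) with Y nonempty to (X, R); (2) every morphism of solutions θ from (X, R) to a Lyubashenko-type YB-solution (Y, R_Y), with partition data (Y_i, f_i, g_i), is a constant map whose single value y ∈ Y_i satisfies f_i(y) = y and g_i(y) = y. -/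
universe u v

/-- Lyubashenko-type partition data for a solution `Ry` on `Y`: a partition `(P i)` of `Y`
and self-maps `f i, g i` of each part, commuting on the part, with
`Ry (y, y') = (f i y, g i y')` whenever `y, y'` lie in the same part `P i`. -/
def LyubData {Y : Type*} {ι : Type*} (Ry : Y × Y → Y × Y) (P : ι → Set Y)
    (f g : ι → Y → Y) : Prop :=
  (∀ y : Y, ∃! i, y ∈ P i) ∧
  (∀ i, ∀ y ∈ P i, f i y ∈ P i ∧ g i y ∈ P i) ∧
  (∀ i, ∀ y ∈ P i, f i (g i y) = g i (f i y)) ∧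
  (∀ i, ∀ y ∈ P i, ∀ y' ∈ P i, Ry (y, y') = (f i y, g i y'))

/-- A property of residues modulo a prime that holds at `0` and is stable under translation by
a nonzero residue holds everywhere. -/
theorem ZMod.forall_of_add_ne_zero {p : ℕ} (hp : p.Prime) {h : ZMod p} (hh : h ≠ 0)
    {S : ZMod p → Prop} (hzero : S 0) (hadd : ∀ x, S x → S (x + h)) (x : ZMod p) : S x := by
  have : Fact p.Prime := ⟨hp⟩
  have mul : ∀ n : ℕ, S (n * h) := by
    intro n
    induction n with
    | zero => simpa using hzero
    | succ n ih =>
      have := hadd _ ih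
      rwa [← add_one_mul, ← Nat.cast_succ] at this
  have := mul (x * h⁻¹).val
  rwa [ZMod.natCast_zmod_val, inv_mul_cancel_right₀ hh] at this

theorem stmt8 (p : ℕ) (hp : p.Prime) (h₁ h₂ : ZMod p) (hnz : ¬(h₁ = 0 ∧ h₂ = 0))
    (R : ZMod p × ZMod p → ZMod p × ZMod p)
    (hR : ∀ x x' : ZMod p, R (x, x') = (x' + h₂, x + h₁)) :
    (∀ (Y : Type u) (Ry : Y × Y → Y × Y), Nonempty Y → IsYB Ry →
      (∃ (ι : Type v) (P : ι → Set Y) (f g : ι → Y → Y), LyubData Ry P f g) →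
      ¬∃ θ : Y → ZMod p, ∀ q : Y × Y, (θ (Ry q).1, θ (Ry q).2) = R (θ q.1, θ q.2)) ∧
    (∀ (Y : Type u) (Ry : Y × Y → Y × Y) (ι : Type v) (P : ι → Set Y) (f g : ι → Y → Y),
      IsYB Ry → LyubData Ry P f g →
      ∀ θ : ZMod p → Y,
        (∀ q : ZMod p × ZMod p, (θ (R q).1, θ (R q).2) = Ry (θ q.1, θ q.2)) →
        ∃ (y : Y) (i : ι), (∀ x : ZMod p, θ x = y) ∧ y ∈ P i ∧ f i y = y ∧ g i y = y) := by
  constructor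
  · rintro Y Ry ⟨y⟩ - ⟨ι, P, f, g, hP, hmem, -, hRy⟩ ⟨θ, hθ⟩
    obtain ⟨i, hi, -⟩ := hP y
    have key : ∀ a ∈ P i, ∀ b ∈ P i, θ (f i a) = θ b + h₂ ∧ θ (g i b) = θ a + h₁ := by
      intro a ha b hb
      simpa [hRy i a ha b hb, hR] using hθ (a, b)
    obtain ⟨hf, hg⟩ := hmem i y hi
    refine hnz ⟨?_, ?_⟩
    · simpa using (key _ hg y hi).2
    · simpa using (key y hi _ hf).1
  · rintro Y Ry ι P f g - ⟨hP, hmem, -, hRy⟩ θ hθ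
    obtain ⟨i, hi, -⟩ := hP (θ 0)
    have key : ∀ x x', θ x ∈ P i → θ x' ∈ P i →
        θ (x' + h₂) = f i (θ x) ∧ θ (x + h₁) = g i (θ x') := by
      intro x x' hx hx'
      simpa [hRy i _ hx _ hx', hR] using hθ (x, x')
    have all : ∀ x, θ x ∈ P i := by
      by_cases hh : h₁ = 0
      · refine ZMod.forall_of_add_ne_zero hp (fun h => hnz ⟨hh, h⟩) hi fun x hx => ?_
        rw [(key x x hx hx).1]
        exact (hmem i _ hx).1
      · refine ZMod.forall_of_add_ne_zero hp hh hi fun x hx => ?_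
        rw [(key x x hx hx).2]
        exact (hmem i _ hx).2
    have const : ∀ x, θ x = f i (θ 0) := by
      intro x
      simpa using (key 0 (x - h₂) (all _) (all _)).1
    have eq_zero : ∀ x, θ x = θ 0 := fun x => (const x).trans (const 0).symm
    exact ⟨θ 0, i, eq_zero, hi, (const 0).symm,
      (key 0 0 hi hi).2.symm.trans (eq_zero _)⟩
end

section
/- Let X be a set and · a binary operation on X. Then (X, ·) is a right Płonka magma (i.e., (x·y)·z = (x·z)·y and x·(y·z) = x·y for all x,y,z ∈ X) if and only if there exist a partition X = ⊔_{i∈I} X_i and functions f_i^j : X_i → X_i for all i, j ∈ I satisfying f_i^j ∘ f_i^k = f_i^k ∘ f_i^j for all i, j, k ∈ I, such that x_i · x_j = f_i^j(x_i) for all x_i ∈ X_i, x_j ∈ X_j and all i, j ∈ I. -/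
/-- A Płonka partition for a multiplication `mul` on `X`: a partition `(P i)_{i ∈ ι}` of `X`
together with maps `f i j : P i → P i` which pairwise commute (in the lower index `i`),
such that `x · y = f i j x` for `x ∈ P i`, `y ∈ P j`. -/
def IsPlonkaPartition {X ι : Type*} (mul : X → X → X) (P : ι → Set X)
    (f : ι → ι → X → X) : Prop :=
  (∀ x : X, ∃! i, x ∈ P i) ∧
  (∀ i j, ∀ x ∈ P i, f i j x ∈ P i) ∧
  (∀ i j k, ∀ x ∈ P i, f i j (f i k x) = f i k (f i j x)) ∧
  (∀ i j, ∀ x ∈ P i, ∀ y ∈ P j, mul x y = f i j x)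

theorem stmt9 {X : Type u} (mul : X → X → X) :
    ((∀ x y z : X, mul (mul x y) z = mul (mul x z) y) ∧
     (∀ x y z : X, mul x (mul y z) = mul x y)) ↔
    ∃ (ι : Type u) (P : ι → Set X) (f : ι → ι → X → X), IsPlonkaPartition mul P f := by
  constructor
  · rintro ⟨hcomm, habs⟩
    -- The blocks are the classes of elements with the same right translation.
    refine ⟨Set.range fun y x => mul x y, fun i => {y | (fun x => mul x y) = i.1},
      fun _ j x => j.1 x, ?_, ?_, ?_, ?_⟩
    · exact fun y => ⟨⟨_, y, rfl⟩, rfl, fun i hi => Subtype.ext hi.symm⟩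
    · rintro i ⟨_, z, rfl⟩ y hy
      exact (funext fun x => habs x y z).trans hy
    · rintro i ⟨_, y, rfl⟩ ⟨_, z, rfl⟩ x -
      exact hcomm x z y
    · exact fun i j x _ y hy => congrFun hy x
  · rintro ⟨ι, P, f, hP, hf, hcomm, hmul⟩
    refine ⟨fun x y z => ?_, fun x y z => ?_⟩
    · obtain ⟨i, hx, -⟩ := hP x
      obtain ⟨j, hy, -⟩ := hP y
      obtain ⟨k, hz, -⟩ := hP z
      rw [hmul i j x hx y hy, hmul i k x hx z hz, hmul i k _ (hf i j x hx) z hz,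
        hmul i j _ (hf i k x hx) y hy, hcomm i k j x hx]
    · obtain ⟨i, hx, -⟩ := hP x
      obtain ⟨j, hy, -⟩ := hP y
      obtain ⟨k, hz, -⟩ := hP z
      rw [hmul j k y hy z hz, hmul i j x hx _ (hf j k y hy), hmul i j x hx y hy]
end

section
/- Let (X, ·) be a right Płonka magma and define the relation a ≈ b on X by: a ≈ b if and only if x·a = x·b for all x ∈ X. Then ≈ is an equivalence relation, and its equivalence classes, together with the maps f_C^D : C → C defined for classes C, D by f_C^D(x) = x·d for any representative d ∈ D (this is well defined), constitute a Płonka partition of (X, ·). Moreover, this Płonka partition is the coarsest one: for every Płonka partition (X_i, f_i^j)_{i,j∈I} of (X, ·), each part X_i is contained in a single ≈-class, and the structure maps f_i^j coincide with the restrictions of the corresponding maps f_C^D. -/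
/-- The relation `a ≈ b` iff `x·a = x·b` for all `x`. -/
def coarseRel {X : Type*} (mul : X → X → X) : X → X → Prop :=
  fun a b => ∀ x : X, mul x a = mul x b

theorem stmt11 {X : Type u} (mul : X → X → X)
    (h1 : ∀ x y z : X, mul (mul x y) z = mul (mul x z) y)
    (h2 : ∀ x y z : X, mul x (mul y z) = mul x y) :
    Equivalence (coarseRel mul) ∧
    (∃ F : Quot (coarseRel mul) → Quot (coarseRel mul) → X → X,
      (∀ (c d : Quot (coarseRel mul)) (x b : X),
        Quot.mk (coarseRel mul) b = d → F c d x = mul x b) ∧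
      IsPlonkaPartition mul (fun c : Quot (coarseRel mul) =>
        {x : X | Quot.mk (coarseRel mul) x = c}) F) ∧
    (∀ (ι : Type v) (P : ι → Set X) (f : ι → ι → X → X), IsPlonkaPartition mul P f →
      (∀ i, ∀ a ∈ P i, ∀ b ∈ P i, coarseRel mul a b) ∧
      (∀ i j, ∀ x ∈ P i, ∀ b ∈ P j, f i j x = mul x b)) := by
  have equiv : Equivalence (coarseRel mul) :=
    ⟨fun _ _ => rfl, fun h x => (h x).symm, fun h h' x => (h x).trans (h' x)⟩
  have rel_of_mk_eq {a b : X} (h : Quot.mk (coarseRel mul) a = Quot.mk (coarseRel mul) b) :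
      coarseRel mul a b := equiv.eqvGen_iff.1 (Quot.eqvGen_exact h)
  have mul_out (x b : X) : mul x (Quot.mk (coarseRel mul) b).out = mul x b :=
    rel_of_mk_eq (Quot.out_eq _) x
  refine ⟨equiv, ⟨fun _ d x => mul x d.out, ?_, ?_, ?_, ?_, ?_⟩, ?_⟩
  · rintro _ _ x b rfl
    exact mul_out x b
  · exact fun x => ⟨Quot.mk _ x, rfl, fun _ h => h.symm⟩
  · rintro _ d x rfl
    exact Quot.sound fun z => h2 z x d.out
  · exact fun _ d e x _ => h1 x e.out d.out
  · rintro _ _ x _ y rfl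
    exact (mul_out x y).symm
  · rintro ι P f ⟨hcover, -, -, hmul⟩
    refine ⟨fun i a ha b hb x => ?_, fun i j x hx b hb => (hmul i j x hx b hb).symm⟩
    obtain ⟨k, hk, -⟩ := hcover x
    rw [hmul k i x hk a ha, hmul k i x hk b hb]
end

section
/- A right Płonka magma (X, ·) is right simple (has no proper nonempty right ideal) if and only if X is a finite set and there exists an incompressible map f : X → X (a cycle of length |X|) such that x·y = f(x) for all x, y ∈ X. Moreover, any two right simple right Płonka magma structures on a finite set X are isomorphic as magmas. -/
/-- A right Płonka magma: `(x·y)·z = (x·z)·y` and `x·(y·z) = x·y`. -/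
def RightPlonka {X : Type*} (mul : X → X → X) : Prop :=
  (∀ x y z : X, mul (mul x y) z = mul (mul x z) y) ∧
  (∀ x y z : X, mul x (mul y z) = mul x y)

/-- `(X, mul)` is right simple: it has no proper nonempty right ideal, i.e. every nonempty
`I` with `I·X ⊆ I` equals `X`. -/
def RightSimple {X : Type*} (mul : X → X → X) : Prop :=
  ∀ I : Set X, I.Nonempty → (∀ a ∈ I, ∀ y : X, mul a y ∈ I) → I = Set.univ

open Function in
theorem IncompressibleMap.exists_iterate_eq {X : Type*} {f : X → X} (hf : IncompressibleMap f)
    (x y : X) : ∃ k : ℕ, f^[k] x = y := by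
  have h : Set.range (fun k : ℕ => f^[k] x) = Set.univ := by
    refine hf _ ⟨x, 0, rfl⟩ ?_
    rintro _ ⟨k, rfl⟩
    exact ⟨k + 1, iterate_succ_apply' f k x⟩
  exact Set.eq_univ_iff_forall.1 h y

open Function in
theorem IncompressibleMap.minimalPeriod_pos {X : Type*} {f : X → X} (hf : IncompressibleMap f)
    (x : X) : 0 < minimalPeriod f x := by
  obtain ⟨k, hk⟩ := hf.exists_iterate_eq (f x) x
  exact IsPeriodicPt.minimalPeriod_pos k.succ_pos hk

open Function in
theorem IncompressibleMap.bijective_iterate {X : Type*} {f : X → X} (hf : IncompressibleMap f)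
    (x : X) : Bijective (fun i : Fin (minimalPeriod f x) => f^[i] x) := by
  refine ⟨fun i j hij => ?_, fun y => ?_⟩
  · exact Fin.ext ((iterate_eq_iterate_iff_of_lt_minimalPeriod i.2 j.2).1 hij)
  · obtain ⟨k, rfl⟩ := hf.exists_iterate_eq x y
    exact ⟨⟨k % minimalPeriod f x, Nat.mod_lt _ (hf.minimalPeriod_pos x)⟩,
      iterate_mod_minimalPeriod_eq⟩

theorem IncompressibleMap.finite {X : Type*} {f : X → X} (hf : IncompressibleMap f) :
    Finite X := by
  cases isEmpty_or_nonempty X with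
  | inl _ => infer_instance
  | inr h => exact h.elim fun x => Finite.of_surjective _ (hf.bijective_iterate x).2

open Function in
theorem IncompressibleMap.minimalPeriod_eq_card {X : Type*} {f : X → X}
    (hf : IncompressibleMap f) (x : X) : minimalPeriod f x = Nat.card X := by
  rw [← Nat.card_eq_of_bijective _ (hf.bijective_iterate x), Nat.card_fin]

open Function in
/-- Any two incompressible self-maps of a type are conjugate. -/
theorem IncompressibleMap.exists_semiconj {X : Type*} {f g : X → X}
    (hf : IncompressibleMap f) (hg : IncompressibleMap g) : ∃ σ : X ≃ X, Semiconj σ f g := by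
  cases isEmpty_or_nonempty X with
  | inl _ => exact ⟨Equiv.refl X, fun x => isEmptyElim x⟩
  | inr h =>
    obtain ⟨x⟩ := h
    have hfg : minimalPeriod f x = minimalPeriod g x := by
      rw [hf.minimalPeriod_eq_card, hg.minimalPeriod_eq_card]
    let e := Equiv.ofBijective _ (hf.bijective_iterate x)
    let e' := Equiv.ofBijective _ (hg.bijective_iterate x)
    let σ : X ≃ X := e.symm.trans ((finCongr hfg).trans e')
    have hσ (k : ℕ) : σ (f^[k] x) = g^[k] x := by
      have hk : e ⟨k % minimalPeriod f x, Nat.mod_lt _ (hf.minimalPeriod_pos x)⟩ = f^[k] x :=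
        iterate_mod_minimalPeriod_eq
      have hk' : g^[k % minimalPeriod f x] x = g^[k] x := by
        rw [hfg, iterate_mod_minimalPeriod_eq]
      rw [← hk, ← hk']
      simp [σ, e']
    refine ⟨σ, fun y => ?_⟩
    obtain ⟨k, rfl⟩ := hf.exists_iterate_eq x y
    rw [← iterate_succ_apply' f, hσ, hσ, iterate_succ_apply']

/-- In a right simple right Płonka magma the product depends only on its left factor, through
an incompressible map. -/
theorem RightPlonka.exists_incompressibleMap {X : Type*} {mul : X → X → X}
    (hP : RightPlonka mul) (hS : RightSimple mul) :
    ∃ f : X → X, IncompressibleMap f ∧ ∀ x y : X, mul x y = f x := by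
  cases isEmpty_or_nonempty X with
  | inl _ => exact ⟨id, fun _ hI => isEmptyElim hI.some, fun x => isEmptyElim x⟩
  | inr h =>
    obtain ⟨y₀⟩ := h
    have hI : {y | ∀ x, mul x y = mul x y₀} = Set.univ :=
      hS _ ⟨y₀, fun _ => rfl⟩ fun y hy z x => (hP.2 x y z).trans (hy x)
    have hmul (x y : X) : mul x y = mul x y₀ := Set.eq_univ_iff_forall.1 hI y x
    refine ⟨fun x => mul x y₀, fun I hne hfI => hS I hne fun a ha y => ?_, hmul⟩
    rw [hmul]
    exact hfI a ha

theorem stmt13 {X : Type*} :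
    (∀ mul : X → X → X, RightPlonka mul →
      (RightSimple mul ↔
        (Finite X ∧ ∃ f : X → X, IncompressibleMap f ∧ ∀ x y : X, mul x y = f x))) ∧
    (Finite X → ∀ mul₁ mul₂ : X → X → X, RightPlonka mul₁ → RightPlonka mul₂ →
      RightSimple mul₁ → RightSimple mul₂ →
      ∃ σ : X ≃ X, ∀ x y : X, σ (mul₁ x y) = mul₂ (σ x) (σ y)) := by
  refine ⟨fun mul hP => ⟨fun hS => ?_, ?_⟩, fun _ mul₁ mul₂ hP₁ hP₂ hS₁ hS₂ => ?_⟩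
  · obtain ⟨f, hf, hmul⟩ := hP.exists_incompressibleMap hS
    exact ⟨hf.finite, f, hf, hmul⟩
  · rintro ⟨_, f, hf, hmul⟩ I ⟨a, ha⟩ hI
    exact hf I ⟨a, ha⟩ fun x hx => hmul x x ▸ hI x hx x
  · obtain ⟨f, hf, hmul₁⟩ := hP₁.exists_incompressibleMap hS₁
    obtain ⟨g, hg, hmul₂⟩ := hP₂.exists_incompressibleMap hS₂
    obtain ⟨σ, hσ⟩ := hf.exists_semiconj hg
    exact ⟨σ, fun x y => by rw [hmul₁, hmul₂, hσ x]⟩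
end

section
/- Let (X, ·, ∗) be a Płonka bi-magma and R = R_{(·,∗)} : X × X → X × X the canonical map R(x,y) = (x·y, x∗y). Then: (1) R is a set-theoretic solution of the quantum Yang–Baxter equation; (2) R is unitary if and only if (x∗y)·x = y for all x, y ∈ X; (3) R is involutive (R ∘ R = id) if and only if (x·y)·y = x and x∗(x∗y) = y for all x, y ∈ X. -/
/-- The flip `τ : X × X → X × X`. -/
def flipMap {X : Type*} : X × X → X × X := fun p => (p.2, p.1)

/-- `R` is unitary: `R` is bijective with `R⁻¹ = τ ∘ R ∘ τ`. -/
def IsUnitary {X : Type*} (R : X × X → X × X) : Prop :=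
  Function.Bijective R ∧ R ∘ (flipMap ∘ R ∘ flipMap) = id ∧ (flipMap ∘ R ∘ flipMap) ∘ R = id

/-- A Płonka bi-magma. -/
def PlonkaBiMagma {X : Type*} (mul star : X → X → X) : Prop :=
  (∀ x y z : X, mul (mul x y) z = mul (mul x z) y) ∧
  (∀ x y z : X, mul x (mul y z) = mul x y) ∧
  (∀ x y z : X, star x (star y z) = star y (star x z)) ∧
  (∀ x y z : X, star (star x y) z = star y z) ∧
  (∀ x y z : X, star x (mul y z) = mul (star x y) z) ∧
  (∀ x y z : X, star (mul x z) y = star x y) ∧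
  (∀ x y z : X, mul x (star y z) = mul x z)

theorem stmt16 {X : Type*} (mul star : X → X → X) (h : PlonkaBiMagma mul star) :
    IsYB (fun p : X × X => (mul p.1 p.2, star p.1 p.2)) ∧
    (IsUnitary (fun p : X × X => (mul p.1 p.2, star p.1 p.2)) ↔
      ∀ x y : X, mul (star x y) x = y) ∧
    (((fun p : X × X => (mul p.1 p.2, star p.1 p.2)) ∘
        (fun p : X × X => (mul p.1 p.2, star p.1 p.2)) = id) ↔
      ((∀ x y : X, mul (mul x y) y = x) ∧ ∀ x y : X, star x (star x y) = y)) := by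
  obtain ⟨mul_right_comm', mul_mul, star_left_comm', star_star, star_mul', mul_star, mul_star_right⟩ := h
  refine ⟨?_, ⟨fun hu x y => ?_, fun hxy => ?_⟩, fun hi => ⟨fun x y => ?_, fun x y => ?_⟩, ?_⟩
  · funext ⟨x, y, z⟩
    simp only [R12, R13, R23, flip23, Function.comp_apply, mul_mul, star_star, star_mul',
      mul_star, mul_star_right, mul_right_comm' x z y, star_left_comm' x y z]
  · simpa only [flipMap, Function.comp_apply, star_star, star_mul', id]
      using congrArg Prod.snd (congrFun hu.2.1 (x, y))
  · have right_inv : (fun p : X × X => (mul p.1 p.2, star p.1 p.2)) ∘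
        (flipMap ∘ (fun p : X × X => (mul p.1 p.2, star p.1 p.2)) ∘ flipMap) = id := by
      funext ⟨x, y⟩
      simp only [flipMap, Function.comp_apply, mul_mul, star_star, star_mul', hxy, id]
    have left_inv : (flipMap ∘ (fun p : X × X => (mul p.1 p.2, star p.1 p.2)) ∘ flipMap) ∘
        (fun p : X × X => (mul p.1 p.2, star p.1 p.2)) = id := by
      funext ⟨x, y⟩
      simp only [flipMap, Function.comp_apply, mul_mul, star_star, star_mul', hxy, id]
    exact ⟨Function.bijective_iff_has_inverse.mpr
      ⟨_, congrFun left_inv, congrFun right_inv⟩, right_inv, left_inv⟩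
  · simpa only [Function.comp_apply, mul_star_right, id] using congrArg Prod.fst (congrFun hi (x, y))
  · simpa only [Function.comp_apply, mul_star, id] using congrArg Prod.snd (congrFun hi (x, y))
  · rintro ⟨hm, hs⟩
    funext ⟨x, y⟩
    simp only [Function.comp_apply, mul_star, mul_star_right, hm, hs, id]
end

section
/- Let X be a set with two binary operations · and ∗, and let R = R_{(·,∗)} : X × X → X × X be the canonical map R(x,y) = (x·y, x∗y). Then R is a BLS-solution (i.e., commutative: R¹²R¹³ = R¹³R¹²; cocommutative: R¹³R²³ = R²³R¹³; and a solution of the Long equation: R¹²R²³ = R²³R¹²) if and only if (X, ·, ∗) is a Płonka bi-magma. In particular, every BLS-solution is a set-theoretic solution of the quantum Yang–Baxter equation R¹²R¹³R²³ = R²³R¹³R¹². -/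
/-- `R` is commutative: `R¹²R¹³ = R¹³R¹²`. -/
def CommutativeSol {X : Type*} (R : X × X → X × X) : Prop :=
  R12 R ∘ R13 R = R13 R ∘ R12 R

/-- `R` is cocommutative: `R¹³R²³ = R²³R¹³`. -/
def CocommutativeSol {X : Type*} (R : X × X → X × X) : Prop :=
  R13 R ∘ R23 R = R23 R ∘ R13 R

/-- `R` satisfies the Long equation: `R¹²R²³ = R²³R¹²`. -/
def LongSol {X : Type*} (R : X × X → X × X) : Prop :=
  R12 R ∘ R23 R = R23 R ∘ R12 R

/-- A BLS-solution: a commutative, cocommutative solution of the Long equation. -/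
def IsBLS {X : Type*} (R : X × X → X × X) : Prop :=
  CommutativeSol R ∧ CocommutativeSol R ∧ LongSol R

theorem IsBLS.isYB {X : Type*} {S : X × X → X × X} (h : IsBLS S) : IsYB S := by
  obtain ⟨hc, hcc, hl⟩ := h
  unfold IsYB
  calc R12 S ∘ R13 S ∘ R23 S = (R12 S ∘ R13 S) ∘ R23 S := rfl
    _ = (R13 S ∘ R12 S) ∘ R23 S := by rw [show R12 S ∘ R13 S = R13 S ∘ R12 S from hc]
    _ = R13 S ∘ (R12 S ∘ R23 S) := rfl
    _ = R13 S ∘ (R23 S ∘ R12 S) := by rw [show R12 S ∘ R23 S = R23 S ∘ R12 S from hl]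
    _ = (R13 S ∘ R23 S) ∘ R12 S := rfl
    _ = (R23 S ∘ R13 S) ∘ R12 S := by rw [show R13 S ∘ R23 S = R23 S ∘ R13 S from hcc]
    _ = R23 S ∘ R13 S ∘ R12 S := rfl

theorem stmt17 {X : Type*} (mul star : X → X → X) :
    (IsBLS (fun p : X × X => (mul p.1 p.2, star p.1 p.2)) ↔ PlonkaBiMagma mul star) ∧
    (∀ S : X × X → X × X, IsBLS S → IsYB S) := by
  refine ⟨?_, fun S h => h.isYB⟩
  simp only [IsBLS, CommutativeSol, CocommutativeSol, LongSol, PlonkaBiMagma, funext_iff,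
    Prod.forall, Function.comp_apply, R12, R13, R23, flip23, Prod.mk.injEq]
  constructor
  · rintro ⟨hc, hcc, hl⟩
    exact ⟨fun x y z => (hc x z y).1, fun x y z => (hl x y z).1, fun x y z => (hcc x y z).2.2,
      fun x y z => (hl x y z).2.2.symm, fun x y z => (hl x y z).2.1,
      fun x y z => (hc x y z).2.1, fun x y z => (hcc x y z).1⟩
  · rintro ⟨h1, h2, h3, h4, h5, h6, h7⟩
    exact ⟨fun x y z => ⟨h1 x z y, h6 x y z, (h6 x z y).symm⟩,
      fun x y z => ⟨h7 x y z, (h7 y x z).symm, h3 x y z⟩,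
      fun x y z => ⟨h2 x y z, h5 x y z, (h4 x y z).symm⟩⟩
end

section
/- Let (X, ·) be a right Płonka magma. Then the map R : X × X → X × X defined by R(x,y) = (x·y, y·x) is a set-theoretic solution of the quantum Yang–Baxter equation. Moreover, R is unitary if and only if (X, ·) is right involutory, i.e., (x·y)·y = x for all x, y ∈ X. -/
theorem stmt18 {X : Type*} (mul : X → X → X)
    (h1 : ∀ x y z : X, mul (mul x y) z = mul (mul x z) y)
    (h2 : ∀ x y z : X, mul x (mul y z) = mul x y) :
    IsYB (fun p : X × X => (mul p.1 p.2, mul p.2 p.1)) ∧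
    (IsUnitary (fun p : X × X => (mul p.1 p.2, mul p.2 p.1)) ↔
      ∀ x y : X, mul (mul x y) y = x) := by
  refine ⟨?_, fun h x y => ?_, fun h => ?_⟩
  · funext ⟨x, y, z⟩
    simp only [R12, R13, R23, flip23, Function.comp_apply, h2, Prod.mk.injEq]
    exact ⟨h1 x z y, h1 y z x, h1 z y x⟩
  · have hxy := congrArg Prod.fst (congrFun h.2.1 (x, y))
    simpa only [Function.comp_apply, flipMap, h2, id_eq] using hxy
  · have hR : Function.Involutive (fun p : X × X => (mul p.1 p.2, mul p.2 p.1)) := by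
      rintro ⟨x, y⟩
      simp only [h2, h]
    exact ⟨hR.bijective, funext hR, funext hR⟩
end

section
/- Let X be a set with two binary operations · and ∗ such that the magma (X, ·) is left cancellative (for each a ∈ X, the map x ↦ a·x is injective) and the magma (X, ∗) is right cancellative (for each a ∈ X, the map x ↦ x∗a is injective). If the canonical map R(x,y) = (x·y, x∗y) satisfies the Long equation R¹²R²³ = R²³R¹², then X has at most one element. In other words, for |X| ≥ 2 the Long equation admits no solution R whose associated bi-magma is left-right cancellative in this sense (in particular, no left-right non-degenerate solutions). -/
theorem stmt19 {X : Type*} (mul star : X → X → X)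
    (hlc : ∀ a : X, Function.Injective fun x => mul a x)
    (hrc : ∀ a : X, Function.Injective fun x => star x a)
    (hLong : LongSol (fun p : X × X => (mul p.1 p.2, star p.1 p.2))) :
    Subsingleton X := by
  have mul_eq_left (y z : X) : mul y z = y :=
    hlc y (congrArg Prod.fst (congrFun hLong (y, y, z)))
  exact ⟨fun x y => hlc x ((mul_eq_left x x).trans (mul_eq_left x y).symm)⟩
end
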